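/- Let f : A → B be a chain map between chain complexes of finite-dimensional vector spaces over the field ZMod 2 that is injective in every degree, is an isomorphism in every degree except one fixed degree p, and has a one-dimensional cokernel in degree p. Then for every degree r ∉ {p−1, p}, the induced map H_r(A) → H_r(B) is an isomorphism; the induced map H_p(A) → H_p(B) is injective; the induced map H_{p−1}(A) → H_{p−1}(B) is surjective; and exactly one of the following two alternatives holds: (i) H_p(A) → H_p(B) has a one-dimensional cokernel and H_{p−1}(A) → H_{p−1}(B) is an isomorphism (the added generator is positive), or (ii) H_p(A) → H_p(B) is an isomorphism and H_{p−1}(A) → H_{p−1}(B) has a one-dimensional kernel (the added generator is negative). -/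

import Mathlib

/-- A chain complex of vector spaces over `ZMod 2` indexed by the natural numbers;
the differential in degree `n` goes to degree `n - 1` (and is zero in degree `0`). -/
structure ChainCx where
  X : ℕ → Type
  [acg : ∀ n, AddCommGroup (X n)]
  [mod : ∀ n, Module (ZMod 2) (X n)]
  d : ∀ n, X n →ₗ[ZMod 2] X (n - 1)
  d_zero : d 0 = 0
  dd : ∀ n, (d n).comp (d (n + 1)) = 0

attribute [instance] ChainCx.acg ChainCx.mod

/-- The degree-`r` cycles. -/
def ChainCx.Z (A : ChainCx) (r : ℕ) : Submodule (ZMod 2) (A.X r) :=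
  LinearMap.ker (A.d r)

/-- The degree-`r` boundaries. -/
def ChainCx.Bd (A : ChainCx) (r : ℕ) : Submodule (ZMod 2) (A.X r) :=
  LinearMap.range (A.d (r + 1))

/-- The degree-`r` homology: cycles modulo boundaries. -/
def ChainCx.homology (A : ChainCx) (r : ℕ) : Type :=
  ↥(A.Z r) ⧸ (A.Bd r).comap (A.Z r).subtype

instance (A : ChainCx) (r : ℕ) : AddCommGroup (A.homology r) :=
  inferInstanceAs (AddCommGroup (↥(A.Z r) ⧸ (A.Bd r).comap (A.Z r).subtype))

instance (A : ChainCx) (r : ℕ) : Module (ZMod 2) (A.homology r) :=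
  inferInstanceAs (Module (ZMod 2) (↥(A.Z r) ⧸ (A.Bd r).comap (A.Z r).subtype))

/-- The homology class of a cycle. -/
def ChainCx.cls (A : ChainCx) (r : ℕ) (c : A.X r) (hc : c ∈ A.Z r) : A.homology r :=
  Submodule.Quotient.mk ⟨c, hc⟩

/-- A chain map between chain complexes over `ZMod 2`. -/
structure ChainMap (A B : ChainCx) where
  f : ∀ n, A.X n →ₗ[ZMod 2] B.X n
  comm : ∀ n, (B.d n).comp (f n) = (f (n - 1)).comp (A.d n)

/-- The identity chain map. -/
def ChainMap.id (A : ChainCx) : ChainMap A A where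
  f _ := LinearMap.id
  comm _ := rfl

/-- Composition of chain maps. -/
def ChainMap.comp {A B C : ChainCx} (g : ChainMap B C) (f : ChainMap A B) :
    ChainMap A C where
  f n := (g.f n).comp (f.f n)
  comm n := by
    rw [← LinearMap.comp_assoc, g.comm n, LinearMap.comp_assoc, f.comm n,
      ← LinearMap.comp_assoc]

lemma ChainMap.mem_Z {A B : ChainCx} (φ : ChainMap A B) (r : ℕ) {c : A.X r}
    (hc : c ∈ A.Z r) : φ.f r c ∈ B.Z r := by
  have h := congrArg (fun g => g c) (φ.comm r)
  simp only [LinearMap.coe_comp, Function.comp_apply] at h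
  have hc' : A.d r c = 0 := hc
  simp only [ChainCx.Z, LinearMap.mem_ker]
  rw [h, hc', map_zero]

/-- The restriction of a chain map to cycles. -/
def ChainMap.zmap {A B : ChainCx} (φ : ChainMap A B) (r : ℕ) :
    ↥(A.Z r) →ₗ[ZMod 2] ↥(B.Z r) :=
  (φ.f r).restrict fun _ hc => φ.mem_Z r hc

lemma ChainMap.zmap_bd {A B : ChainCx} (φ : ChainMap A B) (r : ℕ) :
    (A.Bd r).comap (A.Z r).subtype ≤
      Submodule.comap (φ.zmap r) ((B.Bd r).comap (B.Z r).subtype) := by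
  rintro ⟨x, hxZ⟩ hx
  simp only [Submodule.mem_comap, Submodule.subtype_apply, ChainCx.Bd,
    LinearMap.mem_range] at hx ⊢
  obtain ⟨y, hy⟩ := hx
  refine ⟨φ.f (r + 1) y, ?_⟩
  have h : B.d (r + 1) (φ.f (r + 1) y) = φ.f r (A.d (r + 1) y) :=
    congrArg (fun g => g y) (φ.comm (r + 1))
  show B.d (r + 1) (φ.f (r + 1) y) = ((φ.zmap r) ⟨x, hxZ⟩ : B.X r)
  exact h.trans (congrArg (φ.f r) hy)

/-- The induced map on degree-`r` homology. -/
def ChainMap.h {A B : ChainCx} (φ : ChainMap A B) (r : ℕ) :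
    A.homology r →ₗ[ZMod 2] B.homology r :=
  Submodule.mapQ _ _ (φ.zmap r) (φ.zmap_bd r)

lemma ChainMap.h_id (A : ChainCx) (r : ℕ) :
    (ChainMap.id A).h r = LinearMap.id := by
  refine Submodule.linearMap_qext _ ?_
  ext x
  rfl

lemma ChainMap.h_comp {A B C : ChainCx} (g : ChainMap B C) (f : ChainMap A B) (r : ℕ) :
    (g.comp f).h r = (g.h r).comp (f.h r) := by
  refine Submodule.linearMap_qext _ ?_
  ext x
  rfl

lemma ChainCx.cls_eq_zero_iff (A : ChainCx) {r : ℕ} {x : A.X r} (hx : x ∈ A.Z r) :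
    A.cls r x hx = 0 ↔ ∃ y : A.X (r + 1), A.d (r + 1) y = x :=
  Submodule.Quotient.mk_eq_zero _

lemma ChainCx.exists_cls_eq (A : ChainCx) {r : ℕ} (a : A.homology r) :
    ∃ x, ∃ hx : x ∈ A.Z r, A.cls r x hx = a := by
  obtain ⟨⟨x, hx⟩, rfl⟩ := Submodule.Quotient.mk_surjective _ a
  exact ⟨x, hx, rfl⟩

lemma ChainCx.d_mem_Z (A : ChainCx) (r : ℕ) (y : A.X (r + 1)) :
    (A.d (r + 1) y : A.X r) ∈ A.Z r :=
  LinearMap.congr_fun (A.dd r) y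

namespace ChainMap

variable {A B : ChainCx} (φ : ChainMap A B)

lemma h_cls {r : ℕ} {x : A.X r} (hx : x ∈ A.Z r) :
    φ.h r (A.cls r x hx) = B.cls r (φ.f r x) (φ.mem_Z r hx) :=
  rfl

lemma d_f (r : ℕ) (y : A.X (r + 1)) :
    B.d (r + 1) (φ.f (r + 1) y) = φ.f r (A.d (r + 1) y) :=
  LinearMap.congr_fun (φ.comm (r + 1)) y

lemma mem_Z_of_f_mem_Z {r : ℕ} (hinj : Function.Injective (φ.f (r - 1))) {x : A.X r}
    (hx : φ.f r x ∈ B.Z r) : x ∈ A.Z r := by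
  refine hinj ?_
  rw [map_zero]
  exact (LinearMap.congr_fun (φ.comm r) x).symm.trans hx

/-- It suffices that every boundary of `B` is the boundary of an element in the image. -/
lemma h_injective {r : ℕ} (hinj : Function.Injective (φ.f r))
    (hd : ∀ w : B.X (r + 1), ∃ y, B.d (r + 1) w = B.d (r + 1) (φ.f (r + 1) y)) :
    Function.Injective (φ.h r) := by
  rw [injective_iff_map_eq_zero]
  intro a ha
  obtain ⟨x, hx, rfl⟩ := A.exists_cls_eq a
  rw [φ.h_cls, B.cls_eq_zero_iff] at ha
  obtain ⟨w, hw⟩ := ha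
  obtain ⟨y, hy⟩ := hd w
  exact (A.cls_eq_zero_iff hx).2 ⟨y, hinj ((φ.d_f r y).symm.trans (hy.symm.trans hw))⟩

/-- It suffices that every cycle of `B` is in the image. -/
lemma h_surjective {r : ℕ} (hinj : Function.Injective (φ.f (r - 1)))
    (hZ : ∀ z ∈ B.Z r, z ∈ LinearMap.range (φ.f r)) :
    Function.Surjective (φ.h r) := by
  intro b
  obtain ⟨z, hz, rfl⟩ := B.exists_cls_eq b
  obtain ⟨x, rfl⟩ := hZ z hz
  exact ⟨A.cls r x (φ.mem_Z_of_f_mem_Z hinj hz), rfl⟩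

/-- A cycle outside the image which spans a complement of the image also spans the cokernel
on homology. -/
lemma finrank_coker_h_eq_one {p : ℕ} (hinj : Function.Injective (φ.f (p - 1)))
    (hsurj : Function.Surjective (φ.f (p + 1))) {z : B.X p} (hz : z ∈ B.Z p)
    (hzr : z ∉ LinearMap.range (φ.f p)) (hspan : ∀ w, ∃ c : ZMod 2, ∃ y, w = φ.f p y + c • z) :
    Module.finrank (ZMod 2) (B.homology p ⧸ LinearMap.range (φ.h p)) = 1 := by
  refine finrank_eq_one (Submodule.Quotient.mk (B.cls p z hz)) ?_ ?_
  · rw [Ne, Submodule.Quotient.mk_eq_zero]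
    rintro ⟨a, ha⟩
    obtain ⟨x, hx, rfl⟩ := A.exists_cls_eq a
    have h0 : B.cls p (z - φ.f p x) (sub_mem hz (φ.mem_Z p hx)) = 0 :=
      sub_eq_zero.2 ha.symm
    obtain ⟨w, hw⟩ := (B.cls_eq_zero_iff _).1 h0
    obtain ⟨y, rfl⟩ := hsurj w
    let v : A.X p := A.d (p + 1) y
    refine hzr ⟨v + x, ?_⟩
    have h1 : φ.f p v = z - φ.f p x := (φ.d_f p y).symm.trans hw
    exact (map_add (φ.f p) _ _).trans (eq_sub_iff_add_eq.1 h1)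
  · intro q
    obtain ⟨b, rfl⟩ := Submodule.Quotient.mk_surjective _ q
    obtain ⟨w, hw, rfl⟩ := B.exists_cls_eq b
    obtain ⟨c, y, rfl⟩ := hspan w
    have hy : φ.f p y ∈ B.Z p := by
      simpa using sub_mem hw ((B.Z p).smul_mem c hz)
    refine ⟨c, ?_⟩
    rw [← Submodule.Quotient.mk_smul, eq_comm, Submodule.Quotient.eq]
    refine ⟨A.cls p y (φ.mem_Z_of_f_mem_Z hinj hy), ?_⟩
    rw [eq_sub_iff_add_eq]
    rfl

/-- If no cycle of `B` lies outside the image, then the boundary of an element spanning a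
complement of the image spans the kernel on homology one degree below. -/
lemma finrank_ker_h_eq_one {r : ℕ} (hinj : ∀ n, Function.Injective (φ.f n))
    (hsurj : Function.Surjective (φ.f r))
    (hZ : ∀ z ∈ B.Z (r + 1), z ∈ LinearMap.range (φ.f (r + 1))) {e : B.X (r + 1)}
    (he : e ∉ LinearMap.range (φ.f (r + 1)))
    (hspan : ∀ w, ∃ c : ZMod 2, ∃ y, w = φ.f (r + 1) y + c • e) :
    Module.finrank (ZMod 2) (LinearMap.ker (φ.h r)) = 1 := by
  obtain ⟨x, hx⟩ := hsurj (B.d (r + 1) e)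
  have hxZ : x ∈ A.Z r := φ.mem_Z_of_f_mem_Z (hinj _) (hx ▸ B.d_mem_Z r e)
  have hker : A.cls r x hxZ ∈ LinearMap.ker (φ.h r) :=
    (B.cls_eq_zero_iff (φ.mem_Z r hxZ)).2 ⟨e, hx.symm⟩
  refine finrank_eq_one ⟨A.cls r x hxZ, hker⟩ ?_ ?_
  · rw [Ne, Submodule.mk_eq_zero, A.cls_eq_zero_iff]
    rintro ⟨y, rfl⟩
    have hcyc : e - φ.f (r + 1) y ∈ B.Z (r + 1) := by
      rw [ChainCx.Z, LinearMap.mem_ker, map_sub, sub_eq_zero]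
      exact hx.symm.trans (φ.d_f r y).symm
    exact he ((Submodule.sub_mem_iff_left _ (LinearMap.mem_range_self _ y)).1 (hZ _ hcyc))
  · rintro ⟨a, ha⟩
    obtain ⟨u, hu, rfl⟩ := A.exists_cls_eq a
    obtain ⟨w, hw⟩ := (B.cls_eq_zero_iff (φ.mem_Z r hu)).1 ha
    obtain ⟨c, y, rfl⟩ := hspan w
    refine ⟨c, Subtype.ext (sub_eq_zero.1 ?_).symm⟩
    refine (A.cls_eq_zero_iff (sub_mem hu ((A.Z r).smul_mem c hxZ))).2 ⟨y, hinj r ?_⟩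
    rw [map_add, map_smul] at hw
    rw [map_sub, map_smul, hx]
    exact (φ.d_f r y).symm.trans (eq_sub_iff_add_eq.2 hw)

end ChainMap

/-- A vector outside a subspace of codimension one spans a complement of it. -/
lemma exists_eq_add_smul_of_finrank_quotient_eq_one {K V W : Type*} [Field K] [AddCommGroup V]
    [Module K V] [AddCommGroup W] [Module K W] {g : V →ₗ[K] W}
    (hg : Module.finrank K (W ⧸ LinearMap.range g) = 1) {e : W} (he : e ∉ LinearMap.range g)
    (w : W) : ∃ c : K, ∃ y, w = g y + c • e := by
  have hne : (Submodule.Quotient.mk e : W ⧸ LinearMap.range g) ≠ 0 := by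
    rwa [Ne, Submodule.Quotient.mk_eq_zero]
  obtain ⟨c, hc⟩ := exists_smul_eq_of_finrank_eq_one hg hne (Submodule.Quotient.mk w)
  rw [← Submodule.Quotient.mk_smul, eq_comm, Submodule.Quotient.eq] at hc
  obtain ⟨y, hy⟩ := hc
  exact ⟨c, y, (eq_sub_iff_add_eq.1 hy).symm⟩

lemma finrank_quotient_range_eq_zero_of_surjective {K V W : Type*} [Field K] [AddCommGroup V]
    [Module K V] [AddCommGroup W] [Module K W] {g : V →ₗ[K] W} (hg : Function.Surjective g) :
    Module.finrank K (W ⧸ LinearMap.range g) = 0 := by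
  have := Submodule.Quotient.subsingleton_iff.2 (LinearMap.range_eq_top.2 hg)
  exact Module.finrank_zero_of_subsingleton

/-- Let `φ : A → B` be a degreewise-injective chain map of chain complexes of
finite-dimensional `ZMod 2`-vector spaces which is an isomorphism in every degree except `p`,
where its cokernel is one-dimensional. Then the induced map on homology is an isomorphism in
every degree other than `p` and `p−1`, is injective in degree `p`, is surjective in degree
`p−1`, and exactly one of the following holds: either it has a one-dimensional cokernel in
degree `p` and is an isomorphism in degree `p−1` (a positive simplex), or it is an isomorphism
in degree `p` and has a one-dimensional kernel in degree `p−1` (a negative simplex).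
(Degree `p−1` is referred to as the `r` with `r + 1 = p`, so that no spurious claim is made
when `p = 0`.) -/
theorem statement_7 (A B : ChainCx)
    [∀ n, FiniteDimensional (ZMod 2) (A.X n)] [∀ n, FiniteDimensional (ZMod 2) (B.X n)]
    (φ : ChainMap A B) (p : ℕ)
    (hinj : ∀ n, Function.Injective (φ.f n))
    (hiso : ∀ r, r ≠ p → Function.Bijective (φ.f r))
    (hcoker : Module.finrank (ZMod 2) (B.X p ⧸ LinearMap.range (φ.f p)) = 1) :
    (∀ r, r + 1 ≠ p → r ≠ p → Function.Bijective (φ.h r)) ∧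
    Function.Injective (φ.h p) ∧
    (∀ r, r + 1 = p → Function.Surjective (φ.h r)) ∧
    Xor'
      (Module.finrank (ZMod 2) (B.homology p ⧸ LinearMap.range (φ.h p)) = 1 ∧
        ∀ r, r + 1 = p → Function.Bijective (φ.h r))
      (Function.Bijective (φ.h p) ∧
        ∀ r, r + 1 = p → Module.finrank (ZMod 2) (LinearMap.ker (φ.h r)) = 1) := by
  have hhinj : ∀ r, r + 1 ≠ p → Function.Injective (φ.h r) := fun r hr =>
    φ.h_injective (hinj r) fun w => ((hiso _ hr).2 w).imp fun _ hy => by rw [hy]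
  have hhsurj : ∀ r, r ≠ p → Function.Surjective (φ.h r) := fun r hr =>
    φ.h_surjective (hinj _) fun z _ => (hiso r hr).2 z
  have hspan := fun {e} => exists_eq_add_smul_of_finrank_quotient_eq_one hcoker (e := e)
  refine ⟨fun r h₁ h₂ => ⟨hhinj r h₁, hhsurj r h₂⟩, hhinj p (by omega),
    fun r hr => hhsurj r (by omega), ?_⟩
  by_cases hZ : ∀ z ∈ B.Z p, z ∈ LinearMap.range (φ.f p)
  · have hsurj : Function.Surjective (φ.h p) := φ.h_surjective (hinj _) hZ
    refine Or.inr ⟨⟨⟨hhinj p (by omega), hsurj⟩, ?_⟩, fun h => ?_⟩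
    · rintro r rfl
      obtain ⟨e, he⟩ : ∃ e, e ∉ LinearMap.range (φ.f (r + 1)) := by
        by_contra! h
        have := finrank_quotient_range_eq_zero_of_surjective (g := φ.f (r + 1)) h
        omega
      exact φ.finrank_ker_h_eq_one hinj (hiso r (by omega)).2 hZ he (hspan he)
    · have := finrank_quotient_range_eq_zero_of_surjective hsurj
      omega
  · push Not at hZ
    obtain ⟨z, hz, hzr⟩ := hZ
    have hc := φ.finrank_coker_h_eq_one (hinj _) (hiso _ (by omega)).2 hz hzr (hspan hzr)
    refine Or.inl ⟨⟨hc, ?_⟩, fun h => ?_⟩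
    · rintro r rfl
      refine ⟨φ.h_injective (hinj r) fun w => ?_, hhsurj r (by omega)⟩
      obtain ⟨c, y, rfl⟩ := hspan hzr w
      have hz0 : B.d (r + 1) z = 0 := hz
      exact ⟨y, by rw [map_add, map_smul, hz0, smul_zero, add_zero]⟩
    · have := finrank_quotient_range_eq_zero_of_surjective h.1.2
      omega
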